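/- Let p be an odd prime and G a non-abelian finite p-group that is d-maximal (d(H) < d(G) for all proper subgroups H). Then Ω_1(G) = ⟨x ∈ G : x^p = 1⟩ is non-abelian, and d(γ_2(G)) ≤ d(G) − 2. -/

import Mathlib

section General

open Subgroup
open scoped commutatorElement

/-- The subgroup generated by all commutators and all `p`-th powers. -/
def powCommutator (p : ℕ) (G : Type*) [Group G] : Subgroup G :=
  Subgroup.closure ({x | ∃ y z : G, ⁅y, z⁆ = x} ∪ {x | ∃ y : G, y ^ p = x})

variable {p : ℕ} {G : Type*} [Group G]

lemma commutator_mem_powCommutator (x y : G) : ⁅x, y⁆ ∈ powCommutator p G :=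
  Subgroup.subset_closure (Or.inl ⟨x, y, rfl⟩)

lemma pow_mem_powCommutator (x : G) : x ^ p ∈ powCommutator p G :=
  Subgroup.subset_closure (Or.inr ⟨x, rfl⟩)

lemma powCommutator_le {K : Subgroup G} (hc : ∀ x y : G, ⁅x, y⁆ ∈ K) (hpow : ∀ x : G, x ^ p ∈ K) :
    powCommutator p G ≤ K := by
  refine (closure_le _).2 ?_
  rintro _ (⟨x, y, rfl⟩ | ⟨x, rfl⟩)
  exacts [hc x y, hpow x]

lemma normal_of_commutator_mem {K : Subgroup G} (hc : ∀ x y : G, ⁅x, y⁆ ∈ K) : K.Normal := by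
  refine ⟨fun n hn g => ?_⟩
  have h := K.mul_mem (hc g n) hn
  rwa [commutatorElement_def, inv_mul_cancel_right] at h

instance powCommutator_normal : (powCommutator p G).Normal :=
  normal_of_commutator_mem commutator_mem_powCommutator

lemma map_powCommutator {H : Type*} [Group H] {f : G →* H} (hf : Function.Surjective f) :
    (powCommutator p G).map f = powCommutator p H := by
  apply le_antisymm
  · rw [map_le_iff_le_comap]
    refine powCommutator_le (fun x y => ?_) fun x => ?_
    · rw [mem_comap, map_commutatorElement]
      exact commutator_mem_powCommutator _ _
    · rw [mem_comap, map_pow]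
      exact pow_mem_powCommutator _
  · refine powCommutator_le (fun x y => ?_) fun x => ?_
    · obtain ⟨x, rfl⟩ := hf x
      obtain ⟨y, rfl⟩ := hf y
      exact ⟨_, commutator_mem_powCommutator x y, map_commutatorElement f x y⟩
    · obtain ⟨x, rfl⟩ := hf x
      exact ⟨_, pow_mem_powCommutator x, map_pow f x p⟩

lemma mul_pow_of_central_commutator {x y w : G} (h : y * x = x * y * w) (hx : Commute w x)
    (hy : Commute w y) (n : ℕ) : (x * y) ^ n = x ^ n * y ^ n * w ^ n.choose 2 := by
  have key (n : ℕ) : y ^ n * x = x * y ^ n * w ^ n := by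
    induction n with
    | zero => simp
    | succ n ih =>
      calc y ^ (n + 1) * x = y ^ n * (y * x) := by rw [pow_succ, mul_assoc]
        _ = (y ^ n * x) * (y * w) := by rw [h]; group
        _ = x * y ^ n * (w ^ n * y) * w := by rw [ih]; group
        _ = x * y ^ (n + 1) * w ^ (n + 1) := by
          rw [(hy.pow_left n).eq]; simp only [pow_succ, mul_assoc]
  induction n with
  | zero => simp
  | succ n ih =>
    calc (x * y) ^ (n + 1) = x ^ n * y ^ n * (w ^ n.choose 2 * (x * y)) := by
          rw [pow_succ, ih]; simp only [mul_assoc]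
      _ = x ^ n * (y ^ n * x) * y * w ^ n.choose 2 := by
          rw [((hx.mul_right hy).pow_left _).eq]; simp only [mul_assoc]
      _ = x ^ n * x * y ^ n * (w ^ n * y) * w ^ n.choose 2 := by
          rw [key]; simp only [mul_assoc]
      _ = x ^ (n + 1) * y ^ (n + 1) * w ^ (n + 1).choose 2 := by
          rw [(hy.pow_left n).eq, Nat.choose_succ_succ' n 1, Nat.choose_one_right, pow_add w n]
          simp only [pow_succ, mul_assoc]

lemma mul_pow_of_central_commutator_of_odd (hp : p.Prime) (hodd : p ≠ 2) {x y w : G}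
    (h : y * x = x * y * w) (hx : Commute w x) (hy : Commute w y) (hw : w ^ p = 1) :
    (x * y) ^ p = x ^ p * y ^ p := by
  obtain ⟨k, hk⟩ : p ∣ p.choose 2 :=
    hp.dvd_choose_self two_ne_zero (lt_of_le_of_ne hp.two_le hodd.symm)
  rw [mul_pow_of_central_commutator h hx hy, hk, pow_mul, hw, one_pow, mul_one]

lemma index_le_pow_rank [Finite G] (hp : p.Prime) (N : Subgroup G) [N.Normal]
    (hc : ∀ x y : G, ⁅x, y⁆ ∈ N) (hpow : ∀ x : G, x ^ p ∈ N) : N.index ≤ p ^ Group.rank G := by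
  let _ : CommGroup (G ⧸ N) :=
    { (inferInstance : Group (G ⧸ N)) with
      mul_comm := by
        intro a b
        induction a using QuotientGroup.induction_on with | H a =>
        induction b using QuotientGroup.induction_on with | H b =>
        rw [← commutatorElement_eq_one_iff_mul_comm]
        exact (QuotientGroup.eq_one_iff _).2 (hc a b) }
  have h1 : Nat.card (G ⧸ N) ∣ p ^ Group.rank (G ⧸ N) := by
    refine card_dvd_exponent_pow_rank' _ fun g => ?_
    induction g using QuotientGroup.induction_on with | H g =>
    exact (QuotientGroup.eq_one_iff _).2 (hpow g)
  have h2 : Group.rank (G ⧸ N) ≤ Group.rank G :=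
    Group.rank_le_of_surjective (QuotientGroup.mk' N) (QuotientGroup.mk'_surjective N)
  exact (Nat.le_of_dvd (pow_pos hp.pos _) h1).trans (Nat.pow_le_pow_right hp.pos h2)

lemma card_le_pow_rank [Finite G] (hp : p.Prime) (H : Subgroup G)
    (hc : ∀ x ∈ H, ∀ y ∈ H, Commute x y) (hpow : ∀ x ∈ H, x ^ p = 1) :
    Nat.card H ≤ p ^ Group.rank H := by
  rw [← index_bot]
  refine index_le_pow_rank hp ⊥ (fun x y => ?_) fun x => ?_
  · rw [mem_bot, commutatorElement_eq_one_iff_commute]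
    exact Subtype.ext (hc x x.2 y y.2)
  · exact Subtype.ext (hpow x x.2)

lemma IsPGroup.le_relIndex [Finite G] (hp : p.Prime) (hG : IsPGroup p G) {H K : Subgroup G}
    (h : H < K) : p ≤ H.relIndex K := by
  have := Fact.mk hp
  obtain ⟨n, hn⟩ := (hG.to_subgroup K).index (H.subgroupOf K)
  rw [relIndex, hn]
  refine Nat.le_self_pow ?_ p
  rintro rfl
  exact h.not_ge (relIndex_eq_one.1 (by simpa [relIndex] using hn))

lemma IsPGroup.exists_finset_closure_sup_eq_top [Finite G] (hp : p.Prime) (hG : IsPGroup p G)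
    (N : Subgroup G) :
    ∃ S : Finset G, Subgroup.closure (S : Set G) ⊔ N = ⊤ ∧ p ^ S.card ≤ N.index := by
  classical
  induction N using WellFoundedGT.induction with | ind N ih =>
  by_cases hN : N = ⊤
  · exact ⟨∅, by simp [hN]⟩
  obtain ⟨x, hx⟩ : ∃ x, x ∉ N := by
    by_contra! h
    exact hN (eq_top_iff.2 fun x _ => h x)
  have hlt : N < Subgroup.closure {x} ⊔ N :=
    right_lt_sup.2 fun h => hx (h (Subgroup.subset_closure rfl))
  obtain ⟨S, hS, hcard⟩ := ih _ hlt
  refine ⟨insert x S, ?_, ?_⟩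
  · rw [Finset.coe_insert, Set.insert_eq, Subgroup.closure_union, sup_comm (Subgroup.closure {x}), sup_assoc, hS]
  · calc p ^ (insert x S).card ≤ p ^ (S.card + 1) :=
          Nat.pow_le_pow_right hp.pos (Finset.card_insert_le _ _)
      _ = p * p ^ S.card := pow_succ' _ _
      _ ≤ N.relIndex (Subgroup.closure {x} ⊔ N) * (Subgroup.closure {x} ⊔ N).index :=
          Nat.mul_le_mul (hG.le_relIndex hp hlt) hcard
      _ = N.index := relIndex_mul_index hlt.le

lemma IsPGroup.powCommutator_le_frattini [Finite G] (hp : p.Prime) (hG : IsPGroup p G) :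
    powCommutator p G ≤ frattini G := by
  have := Fact.mk hp
  refine le_iInf₂ fun M hM => ?_
  have hnil : Group.IsNilpotent G := hG.isNilpotent
  have hnorm : M.Normal :=
    NormalizerCondition.normal_of_coatom M Group.normalizerCondition_of_isNilpotent hM
  have hsup {x : G} (hx : x ∉ M) (y : G) : ∃ k : ℤ, ∃ m ∈ M, x ^ k * m = y := by
    have htop : zpowers x ⊔ M = ⊤ :=
      hM.2 _ (right_lt_sup.2 fun h => hx (h (mem_zpowers x)))
    have hy : y ∈ zpowers x ⊔ M := htop ▸ mem_top y
    obtain ⟨_, ⟨k, rfl⟩, m, hm, h⟩ := mem_sup_of_normal_right.1 hy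
    exact ⟨k, m, hm, h⟩
  refine powCommutator_le (fun x y => ?_) fun x => ?_
  · by_cases hx : x ∈ M
    · rw [commutatorElement_def, mul_assoc, mul_assoc]
      refine M.mul_mem hx ?_
      rw [← mul_assoc]
      exact hnorm.conj_mem _ (M.inv_mem hx) y
    · obtain ⟨k, m, hm, rfl⟩ := hsup hx y
      have : ⁅x, x ^ k * m⁆ = x ^ k * ((x * m * x⁻¹) * m⁻¹) * (x ^ k)⁻¹ := by
        rw [commutatorElement_def, ← mul_assoc x, (Commute.self_zpow x k).eq]
        group
      rw [this]
      exact hnorm.conj_mem _ (M.mul_mem (hnorm.conj_mem _ hm _) (M.inv_mem hm)) _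
  · by_contra hxp
    obtain ⟨k, m, hm, h⟩ := hsup hxp x
    have hmem : x ^ (1 - p * k : ℤ) ∈ M := by
      have : x ^ (1 - p * k : ℤ) = m := by
        rw [sub_eq_neg_add, zpow_add, zpow_neg, zpow_mul, zpow_natCast, zpow_one,
          inv_mul_eq_iff_eq_mul, h]
      rwa [this]
    obtain ⟨n, hn⟩ := hG x
    have hcop : IsCoprime (1 - p * k : ℤ) ((p ^ n : ℕ) : ℤ) := by
      push_cast
      exact IsCoprime.pow_right ⟨1, k, by ring⟩
    obtain ⟨a, b, hab⟩ := hcop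
    apply hxp
    apply M.pow_mem
    have : x = (x ^ (1 - p * k : ℤ)) ^ a := by
      conv_lhs => rw [← zpow_one x, ← hab, zpow_add, mul_comm b, zpow_mul x _ b, zpow_natCast, hn,
        one_zpow, mul_one, mul_comm, zpow_mul]
    rw [this]
    exact M.zpow_mem hmem a

lemma IsPGroup.pow_rank_le_index_powCommutator [Finite G] (hp : p.Prime) (hG : IsPGroup p G) :
    p ^ Group.rank G ≤ (powCommutator p G).index := by
  obtain ⟨S, hS, hcard⟩ := hG.exists_finset_closure_sup_eq_top hp (powCommutator p G)
  have htop : Subgroup.closure (S : Set G) = ⊤ := frattini_nongenerating <|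
    top_le_iff.1 (hS.symm.le.trans (sup_le_sup_left (hG.powCommutator_le_frattini hp) _))
  exact (Nat.pow_le_pow_right hp.pos (Group.rank_le htop)).trans hcard

lemma IsPGroup.pow_rank_le_card [Finite G] (hp : p.Prime) (hG : IsPGroup p G) :
    p ^ Group.rank G ≤ Nat.card G := by
  obtain ⟨S, hS, hcard⟩ := hG.exists_finset_closure_sup_eq_top hp ⊥
  rw [sup_bot_eq] at hS
  exact (Nat.pow_le_pow_right hp.pos (Group.rank_le hS)).trans (hcard.trans index_bot.le)

lemma IsPGroup.exists_central_of_normal [Finite G] (hp : p.Prime) (hG : IsPGroup p G)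
    (N : Subgroup G) [N.Normal] (hN : N ≠ ⊥) : ∃ z ∈ N, z ∈ center G ∧ orderOf z = p := by
  have := Fact.mk hp
  have hC : IsPGroup p (ConjAct G) := hG.of_equiv ConjAct.toConjAct
  have hdvd : p ∣ Nat.card N := by
    rcases (hG.to_subgroup N).card_eq_or_dvd with h | h
    · exact absurd (card_eq_one.1 h) hN
    · exact h
  obtain ⟨b, hb, hb1⟩ := hC.exists_fixed_point_of_prime_dvd_card_of_fixed_point N hdvd
    (a := 1) (by intro g; exact Subtype.ext (by simp))
  have hbc : (b : G) ∈ center G := by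
    rw [mem_center_iff]
    intro g
    have h := congrArg Subtype.val (hb (ConjAct.toConjAct g))
    rw [ConjAct.Subgroup.val_conj_smul, ConjAct.toConjAct_smul] at h
    rw [← mul_inv_eq_iff_eq_mul, h]
  have hpo : p ∣ orderOf (b : G) := hG.dvd_orderOf fun h => hb1 (Subtype.ext h.symm)
  obtain ⟨m, hm⟩ := hpo
  refine ⟨b ^ m, N.pow_mem b.2 m, (center G).pow_mem hbc m, ?_⟩
  have hpos := orderOf_pos (b : G)
  rw [orderOf_pow_of_dvd (by rintro rfl; simp [hm] at hpos) ⟨p, by rw [hm, mul_comm]⟩, hm]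
  exact Nat.mul_div_cancel _ (Nat.pos_of_ne_zero (by rintro rfl; simp [hm] at hpos))

end General

section Maximal

open Subgroup
open scoped commutatorElement

universe u

variable {p : ℕ} {G : Type u} [Group G]

lemma commutatorElement_mul_mul_of_commute {x y m n : G} (hmx : Commute m x) (hmy : Commute m y)
    (hnx : Commute n x) (hny : Commute n y) (hmn : Commute m n) : ⁅m * x, n * y⁆ = ⁅x, y⁆ := by
  have h1 : m * x * (n * y) = m * n * (x * y) := hnx.symm.mul_mul_mul_comm m y
  have h2 : n * y * (m * x) = m * n * (y * x) := by
    rw [hmn.eq]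
    exact hmy.symm.mul_mul_mul_comm n x
  have h3 : Commute (m * n) ⁅x, y⁆ := by
    rw [commutatorElement_def]
    have hx := hmx.mul_left hnx
    have hy := hmy.mul_left hny
    exact ((hx.mul_right hy).mul_right hx.inv_right).mul_right hy.inv_right
  calc ⁅m * x, n * y⁆ = m * x * (n * y) * (n * y * (m * x))⁻¹ := by
        rw [commutatorElement_def]; group
    _ = m * n * ⁅x, y⁆ * (m * n)⁻¹ := by rw [h1, h2, commutatorElement_def]; group
    _ = ⁅x, y⁆ := by rw [h3.eq, mul_inv_cancel_right]

lemma IsPGroup.index_centralizer_le [Finite G] (hp : p.Prime) (hG : IsPGroup p G)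
    {K M : Subgroup G} (hM : Nat.card M = p) (hcomm : ∀ a ∈ K, ∀ g : G, ⁅a, g⁆ ∈ M) :
    (centralizer (K : Set G)).index ≤ (center G).relIndex K := by
  obtain ⟨S, hS, hcard⟩ := (hG.to_subgroup K).exists_finset_closure_sup_eq_top hp
    ((center G).subgroupOf K)
  let f (g : G) (s : S) : M := ⟨⁅(s : K).1, g⁆, hcomm _ (s : K).2 g⟩
  have hf {g h : G} (hgh : f g = f h) : g⁻¹ * h ∈ centralizer (K : Set G) := by
    have hle : Subgroup.closure (S : Set K) ⊔ (center G).subgroupOf K ≤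
        (centralizer {g⁻¹ * h}).subgroupOf K := by
      refine sup_le ((closure_le _).2 fun s hs => ?_) fun s hs => ?_
      · have h1 : ⁅(s : G), g⁆ = ⁅(s : G), h⁆ := congrArg Subtype.val (congrFun hgh ⟨s, hs⟩)
        rw [commutatorElement_def, commutatorElement_def, mul_assoc, mul_assoc, mul_assoc,
          mul_assoc, mul_right_inj] at h1
        simp only [SetLike.mem_coe, mem_subgroupOf, mem_centralizer_singleton_iff]
        have h2 : (s : G)⁻¹ * (g⁻¹ * h) = g⁻¹ * h * (s : G)⁻¹ := by
          calc (s : G)⁻¹ * (g⁻¹ * h) = g⁻¹ * (g * ((s : G)⁻¹ * g⁻¹)) * h := by group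
            _ = g⁻¹ * h * (s : G)⁻¹ := by rw [h1]; group
        exact (Commute.inv_left_iff.1 h2).eq
      · rw [mem_subgroupOf] at hs ⊢
        rw [mem_centralizer_singleton_iff]
        exact (mem_center_iff.1 hs _).symm
    rw [hS] at hle
    rw [mem_centralizer_iff]
    intro k hk
    have := hle (mem_top (⟨k, hk⟩ : K))
    rwa [mem_subgroupOf, mem_centralizer_singleton_iff] at this
  have hinj : Function.Injective fun q : G ⧸ centralizer (K : Set G) => f q.out := by
    intro a b hab
    rw [← QuotientGroup.out_eq' a, ← QuotientGroup.out_eq' b]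
    exact QuotientGroup.eq.2 (hf hab)
  have h1 := Nat.card_le_card_of_injective _ hinj
  rw [Nat.card_fun, hM] at h1
  exact h1.trans (by simpa [relIndex] using hcard)

lemma IsPGroup.powCommutator_le_center_of_commutator_le [Finite G] (hp : p.Prime) (hodd : p ≠ 2)
    (hG : IsPGroup p G) {d : ℕ} (hidx : p ^ d ≤ (powCommutator p G).index)
    (hrank : ∀ H : Subgroup G, H ≠ ⊤ → Group.rank H < d) {M : Subgroup G} (hM : Nat.card M = p)
    (hMc : M ≤ center G) (hcomm : ∀ a ∈ powCommutator p G, ∀ g : G, ⁅a, g⁆ ∈ M) :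
    powCommutator p G ≤ center G := by
  set K := powCommutator p G
  set C := centralizer (K : Set G)
  have hMcomm {m : G} (hm : m ∈ M) (g : G) : Commute m g := (mem_center_iff.1 (hMc hm) g).symm
  have hMpow {m : G} (hm : m ∈ M) : m ^ p = 1 := by
    have := pow_card_eq_one' (x := (⟨m, hm⟩ : M))
    rw [hM] at this
    exact congrArg Subtype.val this
  have hconj (x y : G) : x * y * x⁻¹ = ⁅x, y⁆ * y := by
    rw [commutatorElement_def, inv_mul_cancel_right]
  have hKK {a b : G} (ha : a ∈ K) (hb : b ∈ K) : Commute a b := by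
    have hle : K ≤ centralizer {a} := by
      refine powCommutator_le (fun x y => ?_) fun x => ?_
      · have hx := hMcomm (hcomm a ha x)
        have hy := hMcomm (hcomm a ha y)
        rw [mem_centralizer_singleton_iff, eq_comm, ← mul_inv_eq_iff_eq_mul,
          conjugate_commutatorElement, hconj, hconj]
        exact commutatorElement_mul_mul_of_commute (hx x) (hx y) (hy x) (hy y) (hx _)
      · rw [mem_centralizer_singleton_iff, eq_comm, ← mul_inv_eq_iff_eq_mul, ← conj_pow, hconj,
          (hMcomm (hcomm a ha x) x).mul_pow, hMpow (hcomm a ha x), one_mul]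
    exact (mem_centralizer_singleton_iff.1 (hle hb)).symm
  have hKC : K ≤ C := fun a ha => mem_centralizer_iff.2 fun b hb => hKK hb ha
  have hCK {c a : G} (hc : c ∈ C) (ha : a ∈ K) : Commute a c := mem_centralizer_iff.1 hc a ha
  have hcc {c c' : G} (hc : c ∈ C) (hc' : c' ∈ C) : ⁅c, c'⁆ ∈ center G := by
    rw [mem_center_iff]
    intro g
    have hg : ⁅g, c⁆ ∈ K := commutator_mem_powCommutator g c
    have hg' : ⁅g, c'⁆ ∈ K := commutator_mem_powCommutator g c'
    rw [← mul_inv_eq_iff_eq_mul, conjugate_commutatorElement, hconj, hconj]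
    exact commutatorElement_mul_mul_of_commute (hCK hc hg) (hCK hc' hg) (hCK hc hg')
      (hCK hc' hg') (hKK hg hg')
  have hcp {c : G} (hc : c ∈ C) : c ^ p ∈ center G := by
    rw [mem_center_iff]
    intro g
    have hu : ⁅c, g⁆ ∈ K := commutator_mem_powCommutator c g
    have hw : ⁅g⁻¹, ⁅c, g⁆⁻¹⁆ ∈ M := by
      rw [← commutatorElement_inv]
      exact M.inv_mem (hcomm _ (K.inv_mem hu) _)
    have hupow : ⁅c, g⁆ ^ p = 1 := by
      have h1 : (⁅c, g⁆ * g) ^ p = ⁅c, g⁆ ^ p * g ^ p :=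
        mul_pow_of_central_commutator_of_odd hp hodd
          (by rw [commutatorElement_def g⁻¹]; group) (hMcomm hw _) (hMcomm hw _) (hMpow hw)
      rw [← hconj, conj_pow, ← (hCK hc (pow_mem_powCommutator g)).eq, mul_inv_cancel_right] at h1
      exact right_eq_mul.1 h1
    have hg : ⁅g, c⁆ ∈ K := commutator_mem_powCommutator g c
    rw [← mul_inv_eq_iff_eq_mul, ← conj_pow, hconj, (hCK hc hg).mul_pow, ← commutatorElement_inv,
      inv_pow, hupow, inv_one, one_mul]
  by_cases htop : C = ⊤
  · exact fun a ha => mem_center_iff.2 fun g =>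
      (hCK (htop ▸ mem_top g : g ∈ C) ha).eq.symm
  exfalso
  have hZ : ((K ⊓ center G).subgroupOf C).index ≤ p ^ Group.rank C := by
    refine index_le_pow_rank hp _ (fun x y => ?_) fun x => ?_
    · exact ⟨commutator_mem_powCommutator _ _, hcc x.2 y.2⟩
    · exact ⟨pow_mem_powCommutator _, hcp x.2⟩
  have h1 : C.index ≤ (center G).relIndex K := hG.index_centralizer_le hp hM hcomm
  have h2 : (K ⊓ center G).relIndex C * C.index = (K ⊓ center G).index :=
    relIndex_mul_index (inf_le_left.trans hKC)
  have h3 : (K ⊓ center G).relIndex K * K.index = (K ⊓ center G).index :=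
    relIndex_mul_index inf_le_left
  rw [inf_relIndex_left] at h3
  have hpos : 0 < C.index := Nat.pos_of_ne_zero index_ne_zero_of_finite
  have h4 : K.index ≤ (K ⊓ center G).relIndex C := by
    refine Nat.le_of_mul_le_mul_left ?_ hpos
    calc C.index * K.index ≤ (center G).relIndex K * K.index := Nat.mul_le_mul_right _ h1
      _ = C.index * (K ⊓ center G).relIndex C := by rw [h3, ← h2, mul_comm]
  exact absurd (hidx.trans (h4.trans hZ))
    (Nat.pow_lt_pow_right hp.one_lt (hrank C htop)).not_ge

theorem IsPGroup.powCommutator_le_center [Finite G] (hp : p.Prime) (hodd : p ≠ 2)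
    (hG : IsPGroup p G) {d : ℕ} (hidx : p ^ d ≤ (powCommutator p G).index)
    (hrank : ∀ H : Subgroup G, H ≠ ⊤ → Group.rank H < d) :
    powCommutator p G ≤ center G := by
  induction hn : Nat.card G using Nat.strong_induction_on generalizing G with | _ n ih =>
  by_cases hbot : powCommutator p G = ⊥
  · rw [hbot]
    exact bot_le
  obtain ⟨z, hzK, hzc, hz⟩ := hG.exists_central_of_normal hp _ hbot
  have hMc : zpowers z ≤ center G := zpowers_le.2 hzc
  have hMK : zpowers z ≤ powCommutator p G := zpowers_le.2 hzK
  have hM : Nat.card (zpowers z) = p := by rw [Nat.card_zpowers, hz]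
  have hnorm : (zpowers z).Normal := ⟨fun n hn g => by
    rwa [mem_center_iff.1 (hMc hn) g, mul_inv_cancel_right]⟩
  have hsurj := QuotientGroup.mk'_surjective (zpowers z)
  have hmap := map_powCommutator (p := p) hsurj
  refine hG.powCommutator_le_center_of_commutator_le hp hodd hidx hrank hM hMc fun a ha g => ?_
  have hcard : Nat.card (G ⧸ zpowers z) < n := by
    have h := card_eq_card_quotient_mul_card_subgroup (zpowers z)
    rw [hM, hn] at h
    rw [h]
    exact lt_mul_of_one_lt_right Nat.card_pos hp.one_lt
  have key : powCommutator p (G ⧸ zpowers z) ≤ center (G ⧸ zpowers z) := by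
    refine ih _ hcard (hG.to_quotient _) ?_ (fun H hH => ?_) rfl
    · rwa [← hmap, index_map_eq _ hsurj (by rwa [QuotientGroup.ker_mk'])]
    · have hne : H.comap (QuotientGroup.mk' (zpowers z)) ≠ ⊤ := fun h => hH <|
        comap_injective hsurj (h.trans (comap_top _).symm)
      refine lt_of_le_of_lt ?_ (hrank _ hne)
      exact Group.rank_le_of_surjective ((QuotientGroup.mk' (zpowers z)).subgroupComap H)
        (MonoidHom.subgroupComap_surjective_of_surjective _ H hsurj)
  have hac : QuotientGroup.mk' (zpowers z) a ∈ center (G ⧸ zpowers z) :=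
    key (hmap ▸ mem_map_of_mem _ ha)
  have := mem_center_iff.1 hac (QuotientGroup.mk' (zpowers z) g)
  rw [← QuotientGroup.ker_mk' (zpowers z), MonoidHom.mem_ker, map_commutatorElement]
  exact commutatorElement_eq_one_iff_mul_comm.2 this.symm

end Maximal

open scoped commutatorElement

/-- For odd `p`, if `G` is a non-abelian `d`-maximal finite `p`-group, then `Ω₁(G)` is
non-abelian and `d(γ₂(G)) ≤ d(G) - 2`. -/
theorem stmt18 {p : ℕ} (hp : p.Prime) (hodd : p ≠ 2) {G : Type*} [Group G] [Finite G]
    (hG : IsPGroup p G) (hnab : ¬ ∀ x y : G, Commute x y)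
    (hmax : ∀ H : Subgroup G, H ≠ ⊤ → Group.rank H < Group.rank G) :
    (¬ ∀ x ∈ Subgroup.closure {x : G | x ^ p = 1},
        ∀ y ∈ Subgroup.closure {x : G | x ^ p = 1}, Commute x y) ∧
      Group.rank (_root_.commutator G) + 2 ≤ Group.rank G := by
  have hidx := hG.pow_rank_le_index_powCommutator hp
  have hcen := hG.powCommutator_le_center hp hodd hidx hmax
  have hcenter {a : G} (ha : a ∈ powCommutator p G) (g : G) : Commute a g :=
    (Subgroup.mem_center_iff.1 (hcen ha) g).symm
  have hcomm (x y : G) : y * x = x * y * ⁅y⁻¹, x⁻¹⁆ := by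
    rw [commutatorElement_def]; group
  have hKmem (x y : G) : ⁅x, y⁆ ∈ powCommutator p G := commutator_mem_powCommutator x y
  have hcpow (x y : G) : ⁅x, y⁆ ^ p = 1 := by
    have h1 : (⁅x, y⁆ * y) ^ p = ⁅x, y⁆ ^ p * y ^ p := (hcenter (hKmem x y) y).mul_pow p
    have h2 : ⁅x, y⁆ * y = x * y * x⁻¹ := by rw [commutatorElement_def]; group
    rw [h2, conj_pow, ← (hcenter (pow_mem_powCommutator y) x).eq, mul_inv_cancel_right] at h1
    exact right_eq_mul.1 h1
  let f : G →* G :=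
    { toFun := fun x => x ^ p
      map_one' := one_pow p
      map_mul' := fun x y => mul_pow_of_central_commutator_of_odd hp hodd (hcomm x y)
        (hcenter (hKmem _ _) x) (hcenter (hKmem _ _) y) (hcpow _ _) }
  have hker {x : G} : x ∈ f.ker ↔ x ^ p = 1 := Iff.rfl
  have hΩ : ¬ ∀ x ∈ f.ker, ∀ y ∈ f.ker, Commute x y := by
    intro hab
    have hcard : p ^ Group.rank G ≤ p ^ Group.rank f.ker := by
      refine le_trans ?_ (card_le_pow_rank hp f.ker hab fun x hx => hx)
      have h1 : Nat.card f.range ≤ Nat.card (powCommutator p G) := by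
        refine Subgroup.card_le_of_le ?_
        rintro _ ⟨x, rfl⟩
        exact pow_mem_powCommutator x
      have h2 : Nat.card f.ker * Nat.card f.range = Nat.card G := by
        rw [← Subgroup.index_ker, Subgroup.card_mul_index]
      have h3 := (powCommutator p G).card_mul_index
      refine hidx.trans (Nat.le_of_mul_le_mul_left ?_
        (Nat.card_pos (α := powCommutator p G)))
      calc _ = Nat.card f.ker * Nat.card f.range := by rw [h3, h2]
        _ ≤ _ := by rw [mul_comm]; exact Nat.mul_le_mul_right _ h1
    have hle := (Nat.pow_le_pow_iff_right hp.one_lt).1 hcard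
    have htop : f.ker = ⊤ := by
      by_contra h
      exact (hmax _ h).not_ge hle
    exact hnab fun x y => hab x (htop ▸ Subgroup.mem_top x) y (htop ▸ Subgroup.mem_top y)
  refine ⟨fun h => hΩ fun x hx y hy =>
    h x (Subgroup.subset_closure hx) y (Subgroup.subset_closure hy), ?_⟩
  push Not at hΩ
  obtain ⟨x, hx, y, -, hxy⟩ := hΩ
  have hKcomm : _root_.commutator G ≤ powCommutator p G := by
    rw [commutator_eq_closure, Subgroup.closure_le]
    rintro _ ⟨a, b, rfl⟩
    exact hKmem a b
  have hkercomm : _root_.commutator G ≤ f.ker := by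
    rw [commutator_eq_closure, Subgroup.closure_le]
    rintro _ ⟨a, b, rfl⟩
    exact hcpow a b
  set H := Subgroup.closure {x} ⊔ _root_.commutator G with hH
  have hlt : _root_.commutator G < H := right_lt_sup.2 fun h =>
    hxy (hcenter (hKcomm (h (Subgroup.subset_closure rfl))) y)
  have hHx {g : G} (hg : g ∈ H) : ∃ k : ℤ, ∃ m ∈ _root_.commutator G, x ^ k * m = g := by
    rw [hH, ← Subgroup.zpowers_eq_closure] at hg
    obtain ⟨_, ⟨k, rfl⟩, m, hm, h⟩ := Subgroup.mem_sup_of_normal_right.1 hg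
    exact ⟨k, m, hm, h⟩
  have hHab : ∀ a ∈ H, ∀ b ∈ H, Commute a b := by
    intro a ha b hb
    obtain ⟨k, m, hm, rfl⟩ := hHx ha
    obtain ⟨l, n, hn, rfl⟩ := hHx hb
    exact (((Commute.refl x).zpow_zpow k l).mul_right (hcenter (hKcomm hn) _).symm).mul_left
      (hcenter (hKcomm hm) _)
  have hHpow : ∀ a ∈ H, a ^ p = 1 := by
    have hle : H ≤ f.ker := sup_le ((Subgroup.closure_le _).2 (by simpa using hx)) hkercomm
    exact fun a ha => hle ha
  have hHtop : H ≠ ⊤ := fun h =>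
    hnab fun a b => hHab a (h ▸ Subgroup.mem_top a) b (h ▸ Subgroup.mem_top b)
  have hrank : p ^ (Group.rank (_root_.commutator G) + 1) ≤ p ^ Group.rank H := by
    calc p ^ (Group.rank (_root_.commutator G) + 1)
        ≤ Nat.card (_root_.commutator G) * (_root_.commutator G).relIndex H := by
          rw [pow_succ]
          exact Nat.mul_le_mul ((hG.to_subgroup _).pow_rank_le_card hp) (hG.le_relIndex hp hlt)
      _ = Nat.card H := by
          rw [← Subgroup.relIndex_bot_left, ← Subgroup.relIndex_bot_left,
            Subgroup.relIndex_mul_relIndex _ _ _ bot_le hlt.le]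
      _ ≤ _ := card_le_pow_rank hp H hHab hHpow
  have h1 := (Nat.pow_le_pow_iff_right hp.one_lt).1 hrank
  have h2 := hmax H hHtop
  omega
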